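/- Let A : ℝ^{n₁×n₂} → ℝ^m be a linear map, X ∈ ℝ^{n₁×n₂}, n ∈ ℝ^m with ‖n‖₂ ≤ ε, b = A(X) + n, and λ > 0. Let X♯ be any minimizer of Z ↦ ‖Z‖_* + (1/(2λ))‖b − A(Z)‖₂², and set H = X♯ − X. Then for any subset E ⊆ {1,…,n₁} with |E| = k, it holds that ‖H_{E^c}‖_* ≤ ‖H_E‖_* + 2‖X_{E^c}‖_* + (ε/λ)‖A(H)‖₂. -/

import Mathlib

open Finset

/-- Frobenius norm of a real matrix. -/
noncomputable def frobNorm {n₁ n₂ : ℕ} (M : Matrix (Fin n₁) (Fin n₂) ℝ) : ℝ :=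
  Real.sqrt (∑ i, ∑ j, M i j ^ 2)

/-- Nuclear norm of a real matrix: sum of its singular values, i.e. of the
square roots of the eigenvalues of `M * Mᵀ`. -/
noncomputable def nucNorm {n₁ n₂ : ℕ} (M : Matrix (Fin n₁) (Fin n₂) ℝ) : ℝ :=
  ∑ i, Real.sqrt ((Matrix.isHermitian_mul_conjTranspose_self M).eigenvalues i)

/-- `A` satisfies the RIP of order `r` with constant `δ`. -/
def HasRIP {n₁ n₂ m : ℕ} (A : Matrix (Fin n₁) (Fin n₂) ℝ →ₗ[ℝ] EuclideanSpace ℝ (Fin m))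
    (r : ℕ) (δ : ℝ) : Prop :=
  ∀ M : Matrix (Fin n₁) (Fin n₂) ℝ, M.rank ≤ r →
    (1 - δ) * frobNorm M ^ 2 ≤ ‖A M‖ ^ 2 ∧ ‖A M‖ ^ 2 ≤ (1 + δ) * frobNorm M ^ 2

/-- The rank-one matrix `s • u vᵀ`. -/
noncomputable def rank1 {n₁ n₂ : ℕ} (s : ℝ) (u : Fin n₁ → ℝ) (v : Fin n₂ → ℝ) :
    Matrix (Fin n₁) (Fin n₂) ℝ :=
  Matrix.of fun a b => s * u a * v b

open Module in
/-- One half of the Courant–Fischer principle, for a test subspace given as the image under `L` of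
the kernel of `K`. -/
theorem LinearMap.IsSymmetric.le_eigenvalues_of_forall_le_inner {V F G : Type*}
    [NormedAddCommGroup V] [InnerProductSpace ℝ V] [FiniteDimensional ℝ V]
    [AddCommGroup F] [Module ℝ F] [FiniteDimensional ℝ F]
    [AddCommGroup G] [Module ℝ G] [FiniteDimensional ℝ G]
    {T : V →ₗ[ℝ] V} (hT : T.IsSymmetric) {N : ℕ} (hN : finrank ℝ V = N)
    (L : F →ₗ[ℝ] V) (K : F →ₗ[ℝ] G) (c : ℝ) (k : Fin N)
    (hk : finrank ℝ G + k < finrank ℝ F)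
    (hL : ∀ x, K x = 0 → L x = 0 → x = 0)
    (h : ∀ x, K x = 0 → c * ‖L x‖ ^ 2 ≤ inner ℝ (L x) (T (L x))) :
    c ≤ hT.eigenvalues hN k := by
  set e := hT.eigenvectorBasis hN
  let Φ : F →ₗ[ℝ] G × (Fin k → ℝ) :=
    K.prod (LinearMap.pi fun j : Fin k =>
      (innerₛₗ ℝ (e ⟨j, j.2.trans k.2⟩)) ∘ₗ L)
  have hker : LinearMap.ker Φ ≠ ⊥ := by
    apply LinearMap.ker_ne_bot_of_finrank_lt
    simpa [Module.finrank_prod] using hk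
  obtain ⟨x, hx, hx0⟩ := (Submodule.ne_bot_iff _).1 hker
  have hx' : K x = 0 ∧ ∀ j : Fin k, inner ℝ (e ⟨j, j.2.trans k.2⟩) (L x) = 0 := by
    simpa [Φ, funext_iff] using hx
  obtain ⟨hK, hj⟩ := hx'
  have hLx : L x ≠ 0 := fun h0 => hx0 (hL x hK h0)
  have hpos : 0 < ‖L x‖ ^ 2 := by positivity
  have h1 : inner ℝ (L x) (T (L x)) ≤ hT.eigenvalues hN k * ‖L x‖ ^ 2 := by
    rw [← e.sum_inner_mul_inner, ← e.sum_sq_norm_inner_right, Finset.mul_sum]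
    refine Finset.sum_le_sum fun j _ => ?_
    have h2 : inner ℝ (e j) (T (L x)) = hT.eigenvalues hN j * inner ℝ (e j) (L x) := by
      rw [← hT, hT.apply_eigenvectorBasis, inner_smul_left]; simp [e]
    rw [h2, real_inner_comm]
    rcases lt_or_ge j k with hjk | hjk
    · have := hj ⟨j, hjk⟩
      simp only [Fin.eta] at this
      simp [this]
    · have := mul_le_mul_of_nonneg_right (hT.eigenvalues_antitone hN hjk)
        (sq_nonneg (inner ℝ (e j) (L x)))
      rw [Real.norm_eq_abs, sq_abs]
      linarith
  exact le_of_mul_le_mul_right ((h x hK).trans h1) hpos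

open Matrix

section Bessel

variable {ι κ : Type*} [Fintype ι] [DecidableEq ι] [Fintype κ]

theorem sum_sq_dotProduct_le {u : ι → κ → ℝ} (hu : ∀ i j, u i ⬝ᵥ u j = if i = j then (1 : ℝ) else 0)
    (x : κ → ℝ) : ∑ i, (u i ⬝ᵥ x) ^ 2 ≤ x ⬝ᵥ x := by
  have ho : Orthonormal ℝ fun i => (WithLp.toLp 2 (u i) : EuclideanSpace ℝ κ) := by
    rw [orthonormal_iff_ite]
    intro i j
    simpa [EuclideanSpace.inner_eq_star_dotProduct, dotProduct_comm] using hu i j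
  have := ho.sum_inner_products_le (WithLp.toLp 2 x) (s := Finset.univ)
  rw [EuclideanSpace.norm_sq_eq] at this
  simpa [EuclideanSpace.inner_eq_star_dotProduct, dotProduct, sq, mul_comm] using this

theorem dotProduct_sum_smul {u : ι → κ → ℝ}
    (hu : ∀ i j, u i ⬝ᵥ u j = if i = j then (1 : ℝ) else 0) (a : ι → ℝ) (i : ι) :
    u i ⬝ᵥ ∑ j, a j • u j = a i := by
  simp [dotProduct_sum, hu]

theorem sum_smul_dotProduct_self {u : ι → κ → ℝ}
    (hu : ∀ i j, u i ⬝ᵥ u j = if i = j then (1 : ℝ) else 0) (a : ι → ℝ) :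
    (∑ j, a j • u j) ⬝ᵥ (∑ j, a j • u j) = ∑ j, a j ^ 2 := by
  rw [sum_dotProduct]
  simp [dotProduct_sum_smul hu, sq]

end Bessel

theorem dotProduct_sum_rank1_mulVec {ι : Type*} [Fintype ι] {n₁ n₂ : ℕ} (s : ι → ℝ)
    (u : ι → Fin n₁ → ℝ) (v : ι → Fin n₂ → ℝ) (x : Fin n₁ → ℝ) (y : Fin n₂ → ℝ) :
    x ⬝ᵥ (∑ i, rank1 (s i) (u i) (v i)) *ᵥ y = ∑ i, s i * ((u i ⬝ᵥ x) * (v i ⬝ᵥ y)) := by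
  have h (i) : rank1 (s i) (u i) (v i) = s i • vecMulVec (u i) (v i) := by
    ext a b; simp [rank1, vecMulVec_apply, mul_assoc]
  simp only [h, sum_mulVec, smul_mulVec, dotProduct_sum, dotProduct_smul, vecMulVec_mulVec,
    smul_eq_mul]
  refine Finset.sum_congr rfl fun i _ => ?_
  simp [dotProduct_comm]

/-- A decomposition of `Z` into rank-one matrices attaining the nuclear norm. -/
theorem exists_eq_sum_rank1_nucNorm {n₁ n₂ : ℕ} (Z : Matrix (Fin n₁) (Fin n₂) ℝ) :
    ∃ (s : Fin n₁ → ℝ) (u : Fin n₁ → Fin n₁ → ℝ) (v : Fin n₁ → Fin n₂ → ℝ),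
      (∀ i, 0 ≤ s i) ∧ (∀ i, u i ⬝ᵥ u i ≤ 1) ∧ (∀ i, v i ⬝ᵥ v i ≤ 1) ∧
      Z = ∑ i, rank1 (s i) (u i) (v i) ∧ ∑ i, s i = nucNorm Z := by
  set hZ := isHermitian_mul_conjTranspose_self Z
  have hpos := (posSemidef_self_mul_conjTranspose Z).eigenvalues_nonneg
  let s : Fin n₁ → ℝ := fun i => √(hZ.eigenvalues i)
  let u : Fin n₁ → Fin n₁ → ℝ := fun i => hZ.eigenvectorBasis i
  let w : Fin n₁ → Fin n₂ → ℝ := fun i => u i ᵥ* Z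
  have huu (i j) : u i ⬝ᵥ u j = if i = j then (1 : ℝ) else 0 := by
    have := orthonormal_iff_ite.1 hZ.eigenvectorBasis.orthonormal i j
    rwa [EuclideanSpace.inner_eq_star_dotProduct, star_trivial, dotProduct_comm] at this
  have hww (i) : w i ⬝ᵥ w i = s i ^ 2 := by
    have h1 : (Z * Zᴴ) *ᵥ u i = hZ.eigenvalues i • u i := hZ.mulVec_eigenvectorBasis i
    have h2 : w i ⬝ᵥ w i = u i ⬝ᵥ (Z * Zᴴ) *ᵥ u i := by
      rw [← mulVec_mulVec, dotProduct_mulVec, conjTranspose_eq_transpose_of_trivial,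
        mulVec_transpose]
    rw [h2, h1, dotProduct_smul, huu, Real.sq_sqrt (hpos i)]
    simp
  have hsw (i) : s i • (s i)⁻¹ • w i = w i := by
    rcases eq_or_ne (s i) 0 with h | h
    · have : w i = 0 := by
        rw [← dotProduct_self_eq_zero, hww, h]; simp
      simp [this]
    · simp [smul_smul, h]
  refine ⟨s, u, fun i => (s i)⁻¹ • w i, fun i => Real.sqrt_nonneg _, fun i => by simp [huu],
    fun i => ?_, ?_, rfl⟩
  · rw [dotProduct_smul, smul_dotProduct, hww]
    rcases eq_or_ne (s i) 0 with h | h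
    · simp [h]
    · simp only [smul_eq_mul]; field_simp; rfl
  · have hsum : ∑ i, vecMulVec (u i) (u i) = (1 : Matrix (Fin n₁) (Fin n₁) ℝ) := by
      have h1 : (Matrix.of u)  * (Matrix.of u)ᵀ = 1 := by
        ext i j; simpa [mul_apply, one_apply, dotProduct] using huu i j
      rw [mul_eq_one_comm] at h1
      rw [← h1]
      ext a b
      simp [mul_apply, Matrix.sum_apply, vecMulVec_apply]
    calc Z = (∑ i, vecMulVec (u i) (u i)) * Z := by rw [hsum, Matrix.one_mul]
      _ = ∑ i, rank1 (s i) (u i) ((s i)⁻¹ • w i) := by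
        rw [Matrix.sum_mul]
        refine Finset.sum_congr rfl fun i _ => ?_
        rw [vecMulVec_mul]
        ext a b
        have := congrFun (hsw i) b
        simp only [Pi.smul_apply, smul_eq_mul] at this
        simp only [vecMulVec_apply, rank1, of_apply, Pi.smul_apply, smul_eq_mul]
        rw [mul_comm (s i), mul_assoc, this]

section Dilation

variable {n₁ n₂ N : ℕ}

theorem EuclideanSpace.norm_sq_sum_eq (x : EuclideanSpace ℝ (Fin n₁ ⊕ Fin n₂)) :
    ‖x‖ ^ 2 = (x.ofLp ∘ Sum.inl) ⬝ᵥ (x.ofLp ∘ Sum.inl) +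
      (x.ofLp ∘ Sum.inr) ⬝ᵥ (x.ofLp ∘ Sum.inr) := by
  rw [EuclideanSpace.norm_sq_eq]
  simp [dotProduct, sq]

variable {T : EuclideanSpace ℝ (Fin n₁ ⊕ Fin n₂) →ₗ[ℝ] EuclideanSpace ℝ (Fin n₁ ⊕ Fin n₂)}
  (hT : T.IsSymmetric) (hN : Module.finrank ℝ (EuclideanSpace ℝ (Fin n₁ ⊕ Fin n₂)) = N)
  {σ : Fin n₁ → ℝ} {u : Fin n₁ → Fin n₁ → ℝ} {v : Fin n₁ → Fin n₂ → ℝ}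
  (hσ0 : ∀ i, 0 ≤ σ i) (hσ : Antitone σ)
  (hu : ∀ i j, u i ⬝ᵥ u j = if i = j then (1 : ℝ) else 0)
  (hv : ∀ i j, v i ⬝ᵥ v j = if i = j then (1 : ℝ) else 0)
  (h : ∀ x, 4 * ∑ i, σ i * ((u i ⬝ᵥ x.ofLp ∘ Sum.inl) * (v i ⬝ᵥ x.ofLp ∘ Sum.inr)) ≤
    inner ℝ x (T x))

include hσ hu hv h in
/-- The leading eigenvalues of an operator dominating twice the self-adjoint dilation of
`∑ i, σ i • u i (v i)ᵀ`. -/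
theorem two_mul_singularValue_le_eigenvalues (i : Fin n₁) (k : Fin N) (hk : (k : ℕ) = i) :
    2 * σ i ≤ hT.eigenvalues hN k := by
  let L : (Fin n₁ → ℝ) →ₗ[ℝ] EuclideanSpace ℝ (Fin n₁ ⊕ Fin n₂) :=
    { toFun := fun a => WithLp.toLp 2 (Sum.elim (∑ j, a j • u j) (∑ j, a j • v j))
      map_add' := fun a b => by
        ext (j | j) <;> simp [add_mul, Finset.sum_add_distrib]
      map_smul' := fun a b => by
        ext (j | j) <;> simp [mul_assoc, Finset.mul_sum] }
  let K : (Fin n₁ → ℝ) →ₗ[ℝ] (Finset.Ioi i → ℝ) := LinearMap.funLeft ℝ ℝ Subtype.val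
  have hl (a) : (L a).ofLp ∘ Sum.inl = ∑ j, a j • u j := rfl
  have hr (a) : (L a).ofLp ∘ Sum.inr = ∑ j, a j • v j := rfl
  have hnorm (a) : ‖L a‖ ^ 2 = 2 * ∑ j, a j ^ 2 := by
    rw [EuclideanSpace.norm_sq_sum_eq, hl, hr, sum_smul_dotProduct_self hu,
      sum_smul_dotProduct_self hv, two_mul]
  refine hT.le_eigenvalues_of_forall_le_inner hN L K _ k ?_ ?_ ?_
  · rw [Module.finrank_fintype_fun_eq_card, Module.finrank_fintype_fun_eq_card,
      Fintype.card_coe, Fin.card_Ioi, Fintype.card_fin, hk]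
    omega
  · intro a _ ha
    have h1 := hnorm a
    rw [ha] at h1
    have h2 : ∑ j, a j ^ 2 = 0 := by simpa using h1.symm
    rw [Finset.sum_eq_zero_iff_of_nonneg fun j _ => sq_nonneg _] at h2
    ext j
    simpa using h2 j
  · intro a ha
    refine le_trans ?_ (h _)
    simp only [hl, hr, dotProduct_sum_smul hu, dotProduct_sum_smul hv, hnorm]
    rw [Finset.mul_sum, Finset.mul_sum, Finset.mul_sum]
    refine Finset.sum_le_sum fun j _ => ?_
    rcases le_or_gt j i with hj | hj
    · nlinarith [mul_le_mul_of_nonneg_right (hσ hj) (sq_nonneg (a j))]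
    · have : a j = 0 := by
        simpa [K] using congrFun ha ⟨j, Finset.mem_Ioi.2 hj⟩
      simp [this]

include hσ0 hu hv h in
/-- The trailing eigenvalues of an operator dominating twice the self-adjoint dilation of
`∑ i, σ i • u i (v i)ᵀ`. -/
theorem neg_two_mul_le_eigenvalues (p : ℕ) {c : ℝ} (hc : 0 ≤ c)
    (hcσ : ∀ j : Fin n₁, p ≤ j → σ j ≤ c) (k : Fin N) (hk : (k : ℕ) + p < N) :
    -(2 * c) ≤ hT.eigenvalues hN k := by
  let K : EuclideanSpace ℝ (Fin n₁ ⊕ Fin n₂) →ₗ[ℝ] ({j : Fin n₁ // (j : ℕ) < p} → ℝ) :=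
    { toFun := fun x j => u j ⬝ᵥ x.ofLp ∘ Sum.inl - v j ⬝ᵥ x.ofLp ∘ Sum.inr
      map_add' := fun x y => by
        ext j
        simp [dotProduct, mul_add, Finset.sum_add_distrib]; ring
      map_smul' := fun a x => by
        ext j
        simp [dotProduct, mul_sub, Finset.mul_sum, mul_left_comm] }
  have hcard : Fintype.card {j : Fin n₁ // (j : ℕ) < p} ≤ p := by
    simpa using Fintype.card_le_of_injective
      (fun j : {j : Fin n₁ // (j : ℕ) < p} => (⟨j, j.2⟩ : Fin p))
      fun a b hab => by simpa [Subtype.ext_iff, Fin.ext_iff] using hab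
  refine hT.le_eigenvalues_of_forall_le_inner hN LinearMap.id K _ k ?_ (fun x _ hx => hx) ?_
  · rw [hN, Module.finrank_fintype_fun_eq_card]; omega
  · intro x hx
    refine le_trans ?_ (h x)
    rw [LinearMap.id_apply, EuclideanSpace.norm_sq_sum_eq]
    have hbu := sum_sq_dotProduct_le hu (x.ofLp ∘ Sum.inl)
    have hbv := sum_sq_dotProduct_le hv (x.ofLp ∘ Sum.inr)
    have hterm : ∑ j, -(2 * c) * ((u j ⬝ᵥ x.ofLp ∘ Sum.inl) ^ 2 + (v j ⬝ᵥ x.ofLp ∘ Sum.inr) ^ 2) ≤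
        4 * ∑ j, σ j * ((u j ⬝ᵥ x.ofLp ∘ Sum.inl) * (v j ⬝ᵥ x.ofLp ∘ Sum.inr)) := by
      rw [Finset.mul_sum]
      refine Finset.sum_le_sum fun j _ => ?_
      set a := u j ⬝ᵥ x.ofLp ∘ Sum.inl
      set b := v j ⬝ᵥ x.ofLp ∘ Sum.inr
      rcases lt_or_ge (j : ℕ) p with hj | hj
      · have hab : a - b = 0 := congrFun hx ⟨j, hj⟩
        rw [sub_eq_zero.1 hab]
        nlinarith [mul_nonneg hc (sq_nonneg b), mul_nonneg (hσ0 j) (sq_nonneg b)]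
      · nlinarith [mul_nonneg (hσ0 j) (sq_nonneg (a + b)),
          mul_nonneg (sub_nonneg.2 (hcσ j hj)) (add_nonneg (sq_nonneg a) (sq_nonneg b))]
    refine le_trans ?_ hterm
    rw [← Finset.mul_sum, Finset.sum_add_distrib]
    nlinarith

end Dilation

/-- A subset form of Mirsky's inequality: for every index set `E`, the nuclear norm of `X + H`
dominates `∑ i, ± (σ i X - σ i H)`, with sign `+` exactly on `E`. -/
theorem sum_singularValues_sub_le_nucNorm_add {n₁ n₂ : ℕ} (hn : n₁ ≤ n₂)
    {X H : Matrix (Fin n₁) (Fin n₂) ℝ}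
    {σX : Fin n₁ → ℝ} {uX : Fin n₁ → Fin n₁ → ℝ} {vX : Fin n₁ → Fin n₂ → ℝ}
    (hσX0 : ∀ i, 0 ≤ σX i) (hσX : Antitone σX)
    (huX : ∀ i j, uX i ⬝ᵥ uX j = if i = j then (1 : ℝ) else 0)
    (hvX : ∀ i j, vX i ⬝ᵥ vX j = if i = j then (1 : ℝ) else 0)
    (hX : X = ∑ i, rank1 (σX i) (uX i) (vX i))
    {σH : Fin n₁ → ℝ} {uH : Fin n₁ → Fin n₁ → ℝ} {vH : Fin n₁ → Fin n₂ → ℝ}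
    (hσH0 : ∀ i, 0 ≤ σH i) (hσH : Antitone σH)
    (huH : ∀ i j, uH i ⬝ᵥ uH j = if i = j then (1 : ℝ) else 0)
    (hvH : ∀ i j, vH i ⬝ᵥ vH j = if i = j then (1 : ℝ) else 0)
    (hH : H = ∑ i, rank1 (σH i) (uH i) (vH i)) (E : Finset (Fin n₁)) :
    ∑ i ∈ E, (σX i - σH i) + ∑ i ∈ Eᶜ, (σH i - σX i) ≤ nucNorm (X + H) := by
  obtain ⟨d, rfl⟩ := Nat.exists_eq_add_of_le' hn
  obtain ⟨s, u, v, hs, hu, hv, hZ, hsum⟩ := exists_eq_sum_rank1_nucNorm (X + H)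
  let P := fromBlocks (∑ i, rank1 (s i) (u i) (u i)) (X - H) (X - H)ᵀ
    (∑ i, rank1 (s i) (v i) (v i))
  have hsymm {n : ℕ} (w : Fin n₁ → Fin n → ℝ) : (∑ i, rank1 (s i) (w i) (w i)).IsHermitian := by
    ext a b
    simp [Matrix.sum_apply, rank1, mul_right_comm]
  have htrace {n : ℕ} (w : Fin n₁ → Fin n → ℝ) (hw : ∀ i, w i ⬝ᵥ w i ≤ 1) :
      (∑ i, rank1 (s i) (w i) (w i)).trace ≤ ∑ i, s i := by
    rw [trace_sum]
    refine Finset.sum_le_sum fun i _ => ?_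
    have : (rank1 (s i) (w i) (w i)).trace = s i * (w i ⬝ᵥ w i) := by
      simp [trace, rank1, dotProduct, Finset.mul_sum, mul_assoc]
    rw [this]
    exact mul_le_of_le_one_right (hs i) (hw i)
  have hP : P.IsHermitian :=
    (hsymm u).fromBlocks (conjTranspose_eq_transpose_of_trivial _) (hsymm v)
  have hT : (toEuclideanLin P).IsSymmetric := isSymmetric_toEuclideanLin_iff.2 hP
  have hN : Module.finrank ℝ (EuclideanSpace ℝ (Fin n₁ ⊕ Fin (d + n₁))) = n₁ + (d + n₁) := by simp
  set μ := hT.eigenvalues hN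
  have htr : ∑ k, μ k ≤ 2 * nucNorm (X + H) := by
    have h1 : (toEuclideanLin P).trace ℝ _ = ∑ k, μ k := hT.trace_eq_sum_eigenvalues hN
    rw [← h1, toEuclideanLin_eq_toLin_orthonormal, trace_toLin_eq, ← hsum]
    have h2 : P.trace = (∑ i, rank1 (s i) (u i) (u i)).trace +
        (∑ i, rank1 (s i) (v i) (v i)).trace := by
      simp [P, trace]
    linarith [htrace u hu, htrace v hv]
  have hform (x : EuclideanSpace ℝ (Fin n₁ ⊕ Fin (d + n₁))) :
      inner ℝ x (toEuclideanLin P x) =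
        ∑ i, s i * ((u i ⬝ᵥ x.ofLp ∘ Sum.inl) ^ 2 + (v i ⬝ᵥ x.ofLp ∘ Sum.inr) ^ 2) +
          2 * (x.ofLp ∘ Sum.inl ⬝ᵥ X *ᵥ (x.ofLp ∘ Sum.inr) -
            x.ofLp ∘ Sum.inl ⬝ᵥ H *ᵥ (x.ofLp ∘ Sum.inr)) := by
    have h1 : inner ℝ x (toEuclideanLin P x) = x.ofLp ⬝ᵥ P *ᵥ x.ofLp := by
      rw [EuclideanSpace.inner_eq_star_dotProduct, star_trivial, dotProduct_comm,
        ofLp_toLpLin, toLin'_apply]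
    have h2 : x.ofLp = Sum.elim (x.ofLp ∘ Sum.inl) (x.ofLp ∘ Sum.inr) := by simp
    rw [h1]
    conv_lhs => rw [h2]
    rw [fromBlocks_mulVec, Sum.elim_comp_inl, Sum.elim_comp_inr, sumElim_dotProduct_sumElim,
      dotProduct_add, dotProduct_add, dotProduct_sum_rank1_mulVec, dotProduct_sum_rank1_mulVec,
      mulVec_transpose, dotProduct_comm _ (_ ᵥ* _), ← dotProduct_mulVec, sub_mulVec,
      dotProduct_sub]
    simp only [mul_add, Finset.sum_add_distrib, sq]
    ring
  have hbound (x : EuclideanSpace ℝ (Fin n₁ ⊕ Fin (d + n₁))) :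
      2 * (x.ofLp ∘ Sum.inl ⬝ᵥ (X + H) *ᵥ (x.ofLp ∘ Sum.inr)) ≤
          ∑ i, s i * ((u i ⬝ᵥ x.ofLp ∘ Sum.inl) ^ 2 + (v i ⬝ᵥ x.ofLp ∘ Sum.inr) ^ 2) ∧
      -(2 * (x.ofLp ∘ Sum.inl ⬝ᵥ (X + H) *ᵥ (x.ofLp ∘ Sum.inr))) ≤
          ∑ i, s i * ((u i ⬝ᵥ x.ofLp ∘ Sum.inl) ^ 2 + (v i ⬝ᵥ x.ofLp ∘ Sum.inr) ^ 2) := by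
    rw [hZ, dotProduct_sum_rank1_mulVec, Finset.mul_sum, ← Finset.sum_neg_distrib]
    constructor <;> refine Finset.sum_le_sum fun i _ => ?_
    · nlinarith [mul_nonneg (hs i) (sq_nonneg (u i ⬝ᵥ x.ofLp ∘ Sum.inl - v i ⬝ᵥ x.ofLp ∘ Sum.inr))]
    · nlinarith [mul_nonneg (hs i) (sq_nonneg (u i ⬝ᵥ x.ofLp ∘ Sum.inl + v i ⬝ᵥ x.ofLp ∘ Sum.inr))]
  have hdomX (x : EuclideanSpace ℝ (Fin n₁ ⊕ Fin (d + n₁))) :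
      4 * ∑ i, σX i * ((uX i ⬝ᵥ x.ofLp ∘ Sum.inl) * (vX i ⬝ᵥ x.ofLp ∘ Sum.inr)) ≤
        inner ℝ x (toEuclideanLin P x) := by
    have h1 := (hbound x).1
    rw [add_mulVec, dotProduct_add] at h1
    rw [hform, ← dotProduct_sum_rank1_mulVec, ← hX]
    linarith
  have hdomH (x : EuclideanSpace ℝ (Fin n₁ ⊕ Fin (d + n₁))) :
      4 * ∑ i, σH i * ((uH i ⬝ᵥ x.ofLp ∘ Sum.inl) * (-vH i ⬝ᵥ x.ofLp ∘ Sum.inr)) ≤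
        inner ℝ x (toEuclideanLin P x) := by
    have h1 := (hbound x).2
    rw [add_mulVec, dotProduct_add] at h1
    simp only [neg_dotProduct, mul_neg, Finset.sum_neg_distrib]
    rw [hform, ← dotProduct_sum_rank1_mulVec, ← hH]
    linarith
  have hvH' : ∀ i j, -vH i ⬝ᵥ -vH j = if i = j then (1 : ℝ) else 0 := by
    simpa using hvH
  have hmid (j : Fin d) : 0 ≤ μ (Fin.natAdd n₁ (Fin.castAdd n₁ j)) := by
    have := neg_two_mul_le_eigenvalues hT hN hσX0 huX hvX hdomX n₁ le_rfl
      (fun j hj => absurd j.2 (not_lt.2 hj)) (Fin.natAdd n₁ (Fin.castAdd n₁ j)) (by simp; omega)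
    simpa using this
  have hindex (i : Fin n₁) :
      (Fin.natAdd n₁ (Fin.natAdd d i.rev) : ℕ) + i < n₁ + (d + n₁) := by
    simp [Fin.val_rev]; omega
  have hpair (i : Fin n₁) :
      2 * (if i ∈ E then σX i - σH i else σH i - σX i) ≤
        μ (Fin.castAdd (d + n₁) i) + μ (Fin.natAdd n₁ (Fin.natAdd d i.rev)) := by
    split_ifs
    · linarith [two_mul_singularValue_le_eigenvalues hT hN hσX huX hvX hdomX i
          (Fin.castAdd (d + n₁) i) rfl,
        neg_two_mul_le_eigenvalues hT hN hσH0 huH hvH' hdomH i (hσH0 i)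
          (fun j hj => hσH hj) _ (hindex i)]
    · linarith [two_mul_singularValue_le_eigenvalues hT hN hσH huH hvH' hdomH i
          (Fin.castAdd (d + n₁) i) rfl,
        neg_two_mul_le_eigenvalues hT hN hσX0 huX hvX hdomX i (hσX0 i)
          (fun j hj => hσX hj) _ (hindex i)]
  have hsplit : ∑ i, (μ (Fin.castAdd (d + n₁) i) + μ (Fin.natAdd n₁ (Fin.natAdd d i.rev))) ≤
      ∑ k, μ k := by
    have hrev := Equiv.sum_comp Fin.revPerm fun i => μ (Fin.natAdd n₁ (Fin.natAdd d i))
    simp only [Fin.revPerm_apply] at hrev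
    rw [Fin.sum_univ_add, Fin.sum_univ_add, Finset.sum_add_distrib, hrev]
    linarith [Finset.sum_nonneg fun j (_ : j ∈ Finset.univ) => hmid j]
  have hE : ∑ i ∈ E, (σX i - σH i) + ∑ i ∈ Eᶜ, (σH i - σX i) =
      ∑ i, if i ∈ E then σX i - σH i else σH i - σX i := by
    rw [← Finset.sum_add_sum_compl E]
    congr 1 <;> refine Finset.sum_congr rfl fun i hi => ?_
    · rw [if_pos hi]
    · rw [if_neg (Finset.mem_compl.1 hi)]
  have := Finset.sum_le_sum fun i (_ : i ∈ Finset.univ) => hpair i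
  rw [← Finset.mul_sum, ← hE] at this
  linarith

/-- The nuclear norm is the sum of the coefficients of any singular value decomposition. -/
theorem nucNorm_eq_sum {n₁ n₂ : ℕ} {X : Matrix (Fin n₁) (Fin n₂) ℝ}
    {σ : Fin n₁ → ℝ} {u : Fin n₁ → Fin n₁ → ℝ} {v : Fin n₁ → Fin n₂ → ℝ}
    (hσ0 : ∀ i, 0 ≤ σ i)
    (hu : ∀ i j, u i ⬝ᵥ u j = if i = j then (1 : ℝ) else 0)
    (hv : ∀ i j, v i ⬝ᵥ v j = if i = j then (1 : ℝ) else 0)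
    (hX : X = ∑ i, rank1 (σ i) (u i) (v i)) : nucNorm X = ∑ i, σ i := by
  have hU : of u * (of u)ᵀ = 1 := by
    ext i j; simpa [mul_apply, one_apply, dotProduct] using hu i j
  have hV : of v * (of v)ᵀ = 1 := by
    ext i j; simpa [mul_apply, one_apply, dotProduct] using hv i j
  have hfac : X = (of u)ᵀ * diagonal σ * of v := by
    rw [hX]
    ext a b
    simp [mul_apply, Matrix.sum_apply, rank1, mul_comm, diagonal_apply]
  have hchar : (X * Xᴴ).charpoly = (diagonal fun i => σ i ^ 2).charpoly := by
    have h1 : X * Xᴴ = (of u)ᵀ * (diagonal (fun i => σ i ^ 2) * of u) := by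
      rw [hfac, conjTranspose_eq_transpose_of_trivial]
      simp only [transpose_mul, diagonal_transpose, transpose_transpose, Matrix.mul_assoc]
      rw [← Matrix.mul_assoc (of v), hV, Matrix.one_mul, ← Matrix.mul_assoc (diagonal σ),
        diagonal_mul_diagonal]
      simp only [sq]
    rw [h1, charpoly_mul_comm, Matrix.mul_assoc, hU, Matrix.mul_one]
  have hroots := (isHermitian_mul_conjTranspose_self X).roots_charpoly_eq_eigenvalues
  rw [hchar, charpoly_diagonal, Polynomial.roots_prod _ _
    (Finset.prod_ne_zero_iff.2 fun i _ => Polynomial.X_sub_C_ne_zero _)] at hroots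
  simp only [Polynomial.roots_X_sub_C, Multiset.bind_singleton] at hroots
  have hsqrt := congrArg (fun m => (m.map Real.sqrt).sum) hroots
  simp only [Multiset.map_map, Function.comp_def, Real.sqrt_sq (hσ0 _)] at hsqrt
  exact hsqrt.symm

theorem stmt4 {n₁ n₂ m k : ℕ} (hn : n₁ ≤ n₂)
    (A : Matrix (Fin n₁) (Fin n₂) ℝ →ₗ[ℝ] EuclideanSpace ℝ (Fin m))
    (X : Matrix (Fin n₁) (Fin n₂) ℝ)
    (nv : EuclideanSpace ℝ (Fin m)) (ε : ℝ) (hnv : ‖nv‖ ≤ ε)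
    (b : EuclideanSpace ℝ (Fin m)) (hb : b = A X + nv)
    (lam : ℝ) (hlam : 0 < lam)
    (Xs : Matrix (Fin n₁) (Fin n₂) ℝ)
    (hXs : ∀ Z : Matrix (Fin n₁) (Fin n₂) ℝ,
      nucNorm Xs + (1 / (2 * lam)) * ‖b - A Xs‖ ^ 2 ≤
        nucNorm Z + (1 / (2 * lam)) * ‖b - A Z‖ ^ 2)
    -- SVD of `X`, with singular values `σX` in decreasing order
    (σX : Fin n₁ → ℝ) (uX : Fin n₁ → Fin n₁ → ℝ) (vX : Fin n₁ → Fin n₂ → ℝ)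
    (hσX0 : ∀ i, 0 ≤ σX i) (hσXmono : ∀ i j : Fin n₁, i ≤ j → σX j ≤ σX i)
    (huX : ∀ i j, ∑ a, uX i a * uX j a = if i = j then (1 : ℝ) else 0)
    (hvX : ∀ i j, ∑ b, vX i b * vX j b = if i = j then (1 : ℝ) else 0)
    (hX : X = ∑ i, rank1 (σX i) (uX i) (vX i))
    -- SVD of `H = Xs - X`, with singular values `σH` in decreasing order
    (σH : Fin n₁ → ℝ) (uH : Fin n₁ → Fin n₁ → ℝ) (vH : Fin n₁ → Fin n₂ → ℝ)
    (hσH0 : ∀ i, 0 ≤ σH i) (hσHmono : ∀ i j : Fin n₁, i ≤ j → σH j ≤ σH i)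
    (huH : ∀ i j, ∑ a, uH i a * uH j a = if i = j then (1 : ℝ) else 0)
    (hvH : ∀ i j, ∑ b, vH i b * vH j b = if i = j then (1 : ℝ) else 0)
    (hH : Xs - X = ∑ i, rank1 (σH i) (uH i) (vH i))
    (E : Finset (Fin n₁)) (hE : E.card = k) :
    (∑ i ∈ Eᶜ, σH i) ≤
      (∑ i ∈ E, σH i) + 2 * (∑ i ∈ Eᶜ, σX i) + (ε / lam) * ‖A (Xs - X)‖ := by
  subst hb
  have hmir := sum_singularValues_sub_le_nucNorm_add hn hσX0 (fun i j => hσXmono i j) huX hvX hX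
    hσH0 (fun i j => hσHmono i j) huH hvH hH E
  rw [add_sub_cancel] at hmir
  have hopt := hXs X
  rw [nucNorm_eq_sum hσX0 huX hvX hX, ← Finset.sum_add_sum_compl E σX] at hopt
  have hfit : ‖nv‖ ^ 2 - ‖nv - A (Xs - X)‖ ^ 2 ≤ 2 * (ε * ‖A (Xs - X)‖) := by
    rw [norm_sub_sq_real]
    nlinarith [real_inner_le_norm nv (A (Xs - X)), sq_nonneg ‖A (Xs - X)‖,
      mul_le_mul_of_nonneg_right hnv (norm_nonneg (A (Xs - X)))]
  have hres : A X + nv - A Xs = nv - A (Xs - X) := by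
    rw [map_sub]; abel
  rw [hres, add_sub_cancel_left] at hopt
  have hscale := mul_le_mul_of_nonneg_left hfit (by positivity : 0 ≤ 1 / (2 * lam))
  have hε : 1 / (2 * lam) * (2 * (ε * ‖A (Xs - X)‖)) = ε / lam * ‖A (Xs - X)‖ := by
    field_simp
  rw [hε, mul_sub] at hscale
  rw [Finset.sum_sub_distrib, Finset.sum_sub_distrib] at hmir
  linarith
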